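/- Let T be an invertible measure-preserving transformation of a standard probability space (X, Σ, μ) and let P = (P_j) be a sequence of finite nonempty subsets of ℤ. Suppose Σ is generated, mod μ-null sets, by a countable family (ℱ_n) of T-invariant sub-σ-algebras such that h_P(T, ℱ_n) = 0 for every n. Then h_P(T) = 0. (Together with the factor inequality this says that the property of having zero P-entropy is hereditarily stable.) -/

import Mathlib

open MeasureTheory
open scoped symmDiff ENNReal

noncomputable section

/-- The Shannon entropy `H(ξ) = -∑ᵢ μ(Cᵢ) log μ(Cᵢ)` of the finite measurable partition
`ξ` of `X` whose cells are the fibers `Cᵢ = f⁻¹{i}` of `f : X → I`. -/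
def partitionEntropy {X I : Type*} [MeasurableSpace X] [Fintype I] (μ : Measure X)
    (f : X → I) : ℝ :=
  ∑ i, Real.negMulLog (μ (f ⁻¹' {i})).toReal

/-- `h_j(T, ξ) = H(⋁_{p ∈ P_j} T^{-p} ξ) / |P_j|`: the normalized entropy of the common
refinement of the partitions `T^{-p}ξ` for `p ∈ P_j`, where `ξ` is the partition of `X`
into the fibers of `f` (the cell of `x` in the refinement is determined by the tuple
`(f (T^p x))_{p ∈ P_j}`). -/
def hPj {X I : Type*} [MeasurableSpace X] [Fintype I] (μ : Measure X) (T : X ≃ᵐ X)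
    (Pj : Finset ℤ) (f : X → I) : ℝ :=
  partitionEntropy μ (fun x => fun p : Pj => f ((T.toEquiv ^ (p : ℤ)) x)) / (Pj.card : ℝ)

/-- `h_P(T, ξ) = limsup_j h_j(T, ξ)`: the `P`-entropy (Kirillov–Kushnirenko entropy) of
`T` with respect to the partition `ξ` of `X` into the fibers of `f`. -/
def hPpart {X I : Type*} [MeasurableSpace X] [Fintype I] (μ : Measure X) (T : X ≃ᵐ X)
    (P : ℕ → Finset ℤ) (f : X → I) : ℝ :=
  Filter.atTop.limsup fun j => hPj μ T (P j) f

/-- `h_P(T, ℱ)`: the `P`-entropy of the factor of `T` on the sub-σ-algebra `m'`, i.e. the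
supremum of `h_P(T, ξ)` over all finite `m'`-measurable partitions `ξ` (realized as
`m'`-measurable maps `f : X → Fin n`), computed in `ℝ≥0∞` (all the quantities
`h_P(T, ξ)` are nonnegative). -/
def hPfactor {X : Type*} (m' : MeasurableSpace X) [MeasurableSpace X] (μ : Measure X)
    (T : X ≃ᵐ X) (P : ℕ → Finset ℤ) : ℝ≥0∞ :=
  ⨆ (n : ℕ) (f : X → Fin n) (_ : Measurable[m'] f), ENNReal.ofReal (hPpart μ T P f)

/-- `h_P(T)`: the `P`-entropy of `T`, the supremum of `h_P(T, ξ)` over all finite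
measurable partitions `ξ`. -/
def hPent {X : Type*} [mX : MeasurableSpace X] (μ : Measure X) (T : X ≃ᵐ X)
    (P : ℕ → Finset ℤ) : ℝ≥0∞ :=
  hPfactor mX μ T P

/-- The sub-σ-algebra `m'` is `T`-invariant mod `μ`-null sets: `T⁻¹ m' = m'` mod null. -/
def InvariantSubAlg {X : Type*} [MeasurableSpace X] (μ : Measure X) (T : X → X)
    (m' : MeasurableSpace X) : Prop :=
  (∀ s, MeasurableSet[m'] s → ∃ t, MeasurableSet[m'] t ∧ μ ((T ⁻¹' s) ∆ t) = 0) ∧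
  (∀ t, MeasurableSet[m'] t → ∃ s, MeasurableSet[m'] s ∧ μ ((T ⁻¹' s) ∆ t) = 0)

namespace Real

lemma negMulLog_sum_le {ι : Type*} (s : Finset ι) (p : ι → ℝ) (hp : ∀ i ∈ s, 0 ≤ p i) :
    negMulLog (∑ i ∈ s, p i) ≤ ∑ i ∈ s, negMulLog (p i) := by
  simp only [negMulLog, neg_mul, Finset.sum_mul, Finset.sum_neg_distrib, neg_le_neg_iff]
  refine Finset.sum_le_sum fun i hi => ?_
  rcases (hp i hi).eq_or_lt with h | h
  · simp [← h]
  · exact mul_le_mul_of_nonneg_left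
      (log_le_log h (Finset.single_le_sum hp hi)) h.le

lemma negMulLog_le_neg_mul_log_sub_mul_log_add {p a b : ℝ} (hp : 0 ≤ p) (ha : p ≤ a)
    (hb : p ≤ b) :
    negMulLog p ≤ -(p * log a) - p * log b + (a * b - p) := by
  rcases hp.eq_or_lt with rfl | h
  · simpa using mul_nonneg ha hb
  · have ha' := h.trans_le ha
    have hb' := h.trans_le hb
    have key := log_le_sub_one_of_pos (div_pos (mul_pos ha' hb') h)
    rw [log_div (mul_pos ha' hb').ne' h.ne', log_mul ha'.ne' hb'.ne'] at key
    have := mul_le_mul_of_nonneg_left key hp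
    have h2 : p * (a * b / p - 1) = a * b - p := by field_simp
    rw [h2] at this
    simp only [negMulLog]
    linarith

/-- Subadditivity of the Shannon entropy of a joint distribution, in terms of its marginals. -/
lemma sum_negMulLog_le_add_marginals {I J : Type*} [Fintype I] [Fintype J] {p : I → J → ℝ}
    (hp : ∀ i j, 0 ≤ p i j) (hsum : ∑ i, ∑ j, p i j = 1) :
    ∑ i, ∑ j, negMulLog (p i j) ≤
      ∑ i, negMulLog (∑ j, p i j) + ∑ j, negMulLog (∑ i, p i j) := by
  have hle (i : I) (j : J) := negMulLog_le_neg_mul_log_sub_mul_log_add (hp i j)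
    (Finset.single_le_sum (fun j _ => hp i j) (Finset.mem_univ j))
    (Finset.single_le_sum (f := fun i => p i j) (fun i _ => hp i j) (Finset.mem_univ i))
  have hsum' : ∑ j, ∑ i, p i j = 1 := by rw [Finset.sum_comm, hsum]
  refine (Finset.sum_le_sum fun i _ => Finset.sum_le_sum fun j _ => hle i j).trans_eq ?_
  simp only [Finset.sum_add_distrib, Finset.sum_sub_distrib, Finset.sum_neg_distrib,
    ← Finset.mul_sum, ← Finset.sum_mul, hsum, hsum', negMulLog, neg_mul]
  rw [Finset.sum_comm (f := fun i j => p i j * log (∑ i, p i j))]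
  simp only [← Finset.sum_mul]
  ring

end Real

section PartitionEntropy

variable {X : Type*} [MeasurableSpace X] {μ : Measure X}

lemma partitionEntropy_nonneg {I : Type*} [Fintype I] [IsProbabilityMeasure μ] (f : X → I) :
    0 ≤ partitionEntropy μ f :=
  Finset.sum_nonneg fun _ _ => Real.negMulLog_nonneg ENNReal.toReal_nonneg measureReal_le_one

lemma measureReal_preimage_comp_singleton [IsFiniteMeasure μ] {I J : Type*} [Fintype I]
    [MeasurableSpace I] [DiscreteMeasurableSpace I] [DecidableEq J]
    {f : X → I} (hf : Measurable f) (φ : I → J) (j : J) :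
    μ.real ((fun x => φ (f x)) ⁻¹' {j}) = ∑ i with φ i = j, μ.real (f ⁻¹' {i}) := by
  rw [sum_measureReal_preimage_singleton _ fun i _ => hf (measurableSet_singleton i)]
  congr 1
  ext x
  simp

variable {I J : Type*} [Fintype I] [MeasurableSpace I] [DiscreteMeasurableSpace I]
  [Fintype J] [MeasurableSpace J] [DiscreteMeasurableSpace J]

lemma partitionEntropy_comp_le [IsFiniteMeasure μ] {f : X → I} (hf : Measurable f)
    {J : Type*} [Fintype J] (φ : I → J) :
    partitionEntropy μ (fun x => φ (f x)) ≤ partitionEntropy μ f := by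
  classical
  unfold partitionEntropy
  rw [← Finset.sum_fiberwise (g := φ)]
  refine Finset.sum_le_sum fun j _ => ?_
  change Real.negMulLog (μ.real _) ≤ _
  rw [measureReal_preimage_comp_singleton hf]
  exact Real.negMulLog_sum_le _ _ fun _ _ => ENNReal.toReal_nonneg

lemma partitionEntropy_prodMk_le [IsProbabilityMeasure μ] {f : X → I} {g : X → J}
    (hf : Measurable f) (hg : Measurable g) :
    partitionEntropy μ (fun x => (f x, g x)) ≤ partitionEntropy μ f + partitionEntropy μ g := by
  classical
  have hfg : Measurable fun x => (f x, g x) := hf.prodMk hg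
  set p : I → J → ℝ := fun i j => μ.real ((fun x => (f x, g x)) ⁻¹' {(i, j)}) with hp
  have h1 (i : I) : μ.real (f ⁻¹' {i}) = ∑ j, p i j := by
    rw [measureReal_preimage_comp_singleton hfg Prod.fst i, Finset.sum_filter,
      Fintype.sum_prod_type, Fintype.sum_eq_single i fun k hk => by simp [hk]]
    simp [p]
  have h2 (j : J) : μ.real (g ⁻¹' {j}) = ∑ i, p i j := by
    rw [measureReal_preimage_comp_singleton hfg Prod.snd j, Finset.sum_filter,
      Fintype.sum_prod_type_right, Fintype.sum_eq_single j fun k hk => by simp [hk]]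
    simp [p]
  have hsum : ∑ i, ∑ j, p i j = 1 := by
    simp_rw [← h1]
    rw [sum_measureReal_preimage_singleton _ fun i _ => hf (measurableSet_singleton i)]
    simp
  unfold partitionEntropy
  rw [Fintype.sum_prod_type]
  simp only [← measureReal_def, h1, h2]
  exact Real.sum_negMulLog_le_add_marginals (fun _ _ => measureReal_nonneg) hsum

lemma partitionEntropy_pi_le [IsProbabilityMeasure μ] {ι : Type*} [DecidableEq ι] {g : ι → X → I}
    (hg : ∀ p, Measurable (g p)) (s : Finset ι) :
    partitionEntropy μ (fun x => fun p : s => g p x) ≤ ∑ p ∈ s, partitionEntropy μ (g p) := by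
  induction s using Finset.induction_on with
  | empty =>
    have (i : (∅ : Finset ι) → I) : (fun (x : X) (p : (∅ : Finset ι)) => g p x) ⁻¹' {i}
        = Set.univ := Set.eq_univ_of_forall fun x => Subsingleton.elim _ _
    simp [partitionEntropy, this]
  | insert a s ha ih =>
    have hs : Measurable fun x => fun p : s => g p x := measurable_pi_lambda _ fun p => hg p
    let φ : I × (s → I) → (↥(insert a s) → I) := fun y p =>
      if h : (p : ι) ∈ s then y.2 ⟨p, h⟩ else y.1
    have hφ : (fun x => fun p : ↥(insert a s) => g p x)
        = fun x => φ (g a x, fun p : s => g p x) := by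
      ext x p
      by_cases h : (p : ι) ∈ s
      · simp [φ, h]
      · simp [φ, (Finset.mem_insert.1 p.2).resolve_right h]
    rw [hφ, Finset.sum_insert ha]
    exact (partitionEntropy_comp_le ((hg a).prodMk hs) φ).trans
      ((partitionEntropy_prodMk_le (hg a) hs).trans (by gcongr))

lemma partitionEntropy_comp_measurePreserving {f : X → I} (hf : Measurable f) {S : X → X}
    (hS : MeasurePreserving S μ μ) :
    partitionEntropy μ (fun x => f (S x)) = partitionEntropy μ f := by
  unfold partitionEntropy
  refine Finset.sum_congr rfl fun i _ => ?_
  rw [← hS.measure_preimage (hf (measurableSet_singleton i)).nullMeasurableSet]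
  rfl

lemma partitionEntropy_mem [IsProbabilityMeasure μ] {s : Set X} (hs : MeasurableSet s) :
    partitionEntropy μ (· ∈ s) = Real.binEntropy (μ.real s) := by
  rw [Real.binEntropy_eq_negMulLog_add_negMulLog_one_sub, ← probReal_compl_eq_one_sub hs]
  have h1 : (· ∈ s) ⁻¹' {True} = s := by ext; simp
  have h2 : (· ∈ s) ⁻¹' {False} = sᶜ := by ext; simp
  simp [partitionEntropy, h1, h2, measureReal_def]

end PartitionEntropy

namespace MeasureTheory.MeasurePreserving

lemma zpow_toEquiv {X : Type*} [MeasurableSpace X] {μ : Measure X} {T : X ≃ᵐ X}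
    (hT : MeasurePreserving T μ μ) (p : ℤ) :
    MeasurePreserving (T.toEquiv ^ p : Equiv.Perm X) μ μ := by
  induction p with
  | zero => exact MeasurePreserving.id μ
  | succ n ih =>
    rw [zpow_add_one]
    exact ih.comp hT
  | pred n ih =>
    rw [zpow_sub_one]
    exact ih.comp (hT.symm T)

end MeasureTheory.MeasurePreserving

lemma MeasureTheory.MeasurePreserving.measurable_orbit {X I : Type*} [MeasurableSpace X]
    [MeasurableSpace I] {μ : Measure X} {T : X ≃ᵐ X} (hT : MeasurePreserving T μ μ) (Q : Finset ℤ)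
    {f : X → I} (hf : Measurable f) :
    Measurable fun x => fun p : Q => f ((T.toEquiv ^ (p : ℤ)) x) :=
  measurable_pi_lambda _ fun p => hf.comp (hT.zpow_toEquiv p).measurable

section HPj

variable {X I J : Type*} [MeasurableSpace X] {μ : Measure X} [IsProbabilityMeasure μ]
  {T : X ≃ᵐ X} (hT : MeasurePreserving T μ μ)
  [Fintype I] [MeasurableSpace I] [DiscreteMeasurableSpace I]
  [Fintype J] [MeasurableSpace J] [DiscreteMeasurableSpace J]

lemma hPj_nonneg {I : Type*} [Fintype I] (Q : Finset ℤ) (f : X → I) : 0 ≤ hPj μ T Q f :=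
  div_nonneg (partitionEntropy_nonneg _) (Nat.cast_nonneg _)

include hT

lemma hPj_le_partitionEntropy (Q : Finset ℤ) {f : X → I} (hf : Measurable f) :
    hPj μ T Q f ≤ partitionEntropy μ f := by
  refine div_le_of_le_mul₀ (Nat.cast_nonneg _) (partitionEntropy_nonneg _) ?_
  refine (partitionEntropy_pi_le (g := fun (p : ℤ) x => f ((T.toEquiv ^ p) x))
    (fun p => hf.comp (hT.zpow_toEquiv p).measurable) Q).trans_eq ?_
  simp [partitionEntropy_comp_measurePreserving hf (hT.zpow_toEquiv _), mul_comm]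

lemma hPj_comp_le (Q : Finset ℤ) {f : X → I} (hf : Measurable f)
    {K : Type*} [Fintype K] (φ : I → K) :
    hPj μ T Q (fun x => φ (f x)) ≤ hPj μ T Q f :=
  div_le_div_of_nonneg_right
    (partitionEntropy_comp_le (hT.measurable_orbit Q hf) fun y p => φ (y p)) (Nat.cast_nonneg _)

lemma hPj_prodMk_le (Q : Finset ℤ) {f : X → I} {g : X → J}
    (hf : Measurable f) (hg : Measurable g) :
    hPj μ T Q (fun x => (f x, g x)) ≤ hPj μ T Q f + hPj μ T Q g := by
  unfold hPj
  rw [← add_div]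
  refine div_le_div_of_nonneg_right ?_ (Nat.cast_nonneg _)
  have hF := hT.measurable_orbit Q hf
  have hG := hT.measurable_orbit Q hg
  exact (partitionEntropy_comp_le (hF.prodMk hG) fun y (p : Q) => (y.1 p, y.2 p)).trans
    (partitionEntropy_prodMk_le hF hG)

lemma hPj_comp₂_le (Q : Finset ℤ) {f : X → I} {g : X → J}
    (hf : Measurable f) (hg : Measurable g) {K : Type*} [Fintype K] (φ : I → J → K) :
    hPj μ T Q (fun x => φ (f x) (g x)) ≤ hPj μ T Q f + hPj μ T Q g :=
  (hPj_comp_le hT Q (hf.prodMk hg) fun y => φ y.1 y.2).trans (hPj_prodMk_le hT Q hf hg)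

end HPj

section ZeroEntropy

open Filter Topology

variable {X I J : Type*} [MeasurableSpace X] {μ : Measure X} [IsProbabilityMeasure μ]
  {T : X ≃ᵐ X} {P : ℕ → Finset ℤ}
  [Fintype I] [MeasurableSpace I] [DiscreteMeasurableSpace I]
  [Fintype J] [MeasurableSpace J] [DiscreteMeasurableSpace J]

lemma tendsto_hPj_of_hPpart_nonpos (hT : MeasurePreserving T μ μ) {f : X → I} (hf : Measurable f)
    (h : hPpart μ T P f ≤ 0) : Tendsto (fun j => hPj μ T (P j) f) atTop (𝓝 0) := by
  have hle : IsBoundedUnder (· ≤ ·) atTop fun j => hPj μ T (P j) f :=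
    isBoundedUnder_of ⟨_, fun j => hPj_le_partitionEntropy hT (P j) hf⟩
  have hge : IsBoundedUnder (· ≥ ·) atTop fun j => hPj μ T (P j) f :=
    isBoundedUnder_of ⟨0, fun j => hPj_nonneg (P j) f⟩
  refine tendsto_of_le_liminf_of_limsup_le ?_ h hle hge
  exact le_liminf_of_le hle.isCoboundedUnder_ge (.of_forall fun j => hPj_nonneg (P j) f)

lemma tendsto_hPj_comp₂ (hT : MeasurePreserving T μ μ) {f : X → I} {g : X → J}
    (hf : Measurable f) (hg : Measurable g)
    (hf0 : Tendsto (fun j => hPj μ T (P j) f) atTop (𝓝 0))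
    (hg0 : Tendsto (fun j => hPj μ T (P j) g) atTop (𝓝 0))
    {K : Type*} [Fintype K] (φ : I → J → K) :
    Tendsto (fun j => hPj μ T (P j) fun x => φ (f x) (g x)) atTop (𝓝 0) :=
  squeeze_zero (fun j => hPj_nonneg (P j) _) (fun j => hPj_comp₂_le hT (P j) hf hg φ)
    (by simpa using hf0.add hg0)

lemma tendsto_hPj_comp (hT : MeasurePreserving T μ μ) {f : X → I} (hf : Measurable f)
    (hf0 : Tendsto (fun j => hPj μ T (P j) f) atTop (𝓝 0)) {K : Type*} [Fintype K] (φ : I → K) :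
    Tendsto (fun j => hPj μ T (P j) fun x => φ (f x)) atTop (𝓝 0) :=
  squeeze_zero (fun j => hPj_nonneg (P j) _) (fun j => hPj_comp_le hT (P j) hf φ) hf0

variable (μ T P) in
/-- The measurable set `s` defines a two-cell partition `{s, sᶜ}` along which the normalized
entropies `h_j` tend to zero. -/
def IsZeroEntropySet (s : Set X) : Prop :=
  MeasurableSet s ∧ Tendsto (fun j => hPj μ T (P j) (· ∈ s)) atTop (𝓝 0)

lemma MeasureTheory.MeasurePreserving.hPj_mem_le_binEntropy (hT : MeasurePreserving T μ μ)
    (Q : Finset ℤ) {s : Set X} (hs : MeasurableSet s) :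
    hPj μ T Q (· ∈ s) ≤ Real.binEntropy (μ.real s) :=
  (hPj_le_partitionEntropy hT Q hs.mem).trans_eq (partitionEntropy_mem hs)

namespace IsZeroEntropySet

lemma compl (hT : MeasurePreserving T μ μ) {s : Set X} (hs : IsZeroEntropySet μ T P s) :
    IsZeroEntropySet μ T P sᶜ :=
  ⟨hs.1.compl, tendsto_hPj_comp hT hs.1.mem hs.2 Not⟩

lemma union (hT : MeasurePreserving T μ μ) {s t : Set X} (hs : IsZeroEntropySet μ T P s)
    (ht : IsZeroEntropySet μ T P t) : IsZeroEntropySet μ T P (s ∪ t) :=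
  ⟨hs.1.union ht.1, tendsto_hPj_comp₂ hT hs.1.mem ht.1.mem hs.2 ht.2 Or⟩

lemma empty (hT : MeasurePreserving T μ μ) : IsZeroEntropySet μ T P ∅ :=
  ⟨.empty, squeeze_zero (fun j => hPj_nonneg (P j) _)
    (fun j => (hT.hPj_mem_le_binEntropy (P j) .empty).trans_eq (by simp)) tendsto_const_nhds⟩

/-- Sets of zero entropy are closed in the measure-algebra metric `μ (s ∆ t)`. -/
lemma of_tendsto (hT : MeasurePreserving T μ μ) {s : Set X} {t : ℕ → Set X}
    (hs : MeasurableSet s) (ht : ∀ n, IsZeroEntropySet μ T P (t n))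
    (h : Tendsto (fun n => μ.real (s ∆ t n)) atTop (𝓝 0)) : IsZeroEntropySet μ T P s := by
  have hH : Tendsto (fun n => Real.binEntropy (μ.real (s ∆ t n))) atTop (𝓝 0) := by
    simpa [Function.comp_def] using (Real.binEntropy_continuous.tendsto 0).comp h
  refine ⟨hs, tendsto_order.2 ⟨fun ε hε => .of_forall fun j => hε.trans_le (hPj_nonneg _ _), fun ε hε => ?_⟩⟩
  obtain ⟨n, hn⟩ := (hH.eventually_lt_const (half_pos hε)).exists
  filter_upwards [(ht n).2.eventually_lt_const (half_pos hε)] with j hj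
  have hd : MeasurableSet (s ∆ t n) := hs.symmDiff (ht n).1
  have hmem : (· ∈ s) = fun x => Xor (x ∈ t n) (x ∈ s ∆ t n) := by
    ext x
    simp only [Set.mem_symmDiff, xor_def]
    tauto
  rw [hmem]
  linarith [hPj_comp₂_le hT (P j) (ht n).1.mem hd.mem Xor, hT.hPj_mem_le_binEntropy (P j) hd]

lemma of_symmDiff_null (hT : MeasurePreserving T μ μ) {s t : Set X} (hs : MeasurableSet s)
    (ht : IsZeroEntropySet μ T P t) (h : μ (s ∆ t) = 0) : IsZeroEntropySet μ T P s :=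
  of_tendsto hT hs (fun _ => ht) (by simp [measureReal_def, h])

lemma iUnion (hT : MeasurePreserving T μ μ) {s : ℕ → Set X}
    (hs : ∀ n, IsZeroEntropySet μ T P (s n)) : IsZeroEntropySet μ T P (⋃ n, s n) := by
  have hacc (n : ℕ) : IsZeroEntropySet μ T P (Set.accumulate s n) := by
    induction n with
    | zero => simpa using hs 0
    | succ n ih => simpa [Set.accumulate_succ] using ih.union hT (hs (n + 1))
  have hU : MeasurableSet (⋃ n, s n) := .iUnion fun n => (hs n).1
  refine of_tendsto hT hU hacc ?_
  have hsub (n : ℕ) : Set.accumulate s n ⊆ ⋃ n, s n := Set.accumulate_subset_iUnion n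
  have hd (n : ℕ) : μ.real ((⋃ n, s n) ∆ Set.accumulate s n)
      = μ.real (⋃ n, s n) - μ.real (Set.accumulate s n) := by
    rw [symmDiff_of_ge (hsub n), measureReal_sdiff (hsub n) (hacc n).1]
  simp only [hd]
  have := (ENNReal.tendsto_toReal (measure_ne_top μ (⋃ n, s n))).comp
    (tendsto_measure_iUnion_accumulate (μ := μ) (f := s))
  simpa [measureReal_def] using this.const_sub (μ.real (⋃ n, s n))

variable (P) in
/-- The sets of zero entropy form a σ-algebra. -/
@[reducible]
def measurableSpace (hT : MeasurePreserving T μ μ) : MeasurableSpace X where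
  MeasurableSet' := IsZeroEntropySet μ T P
  measurableSet_empty := empty hT
  measurableSet_compl _ := compl hT
  measurableSet_iUnion _ := iUnion hT

end IsZeroEntropySet

lemma isZeroEntropySet_of_hPfactor_eq_zero {X : Type*} {m : MeasurableSpace X}
    [mX : MeasurableSpace X] {μ : Measure X} [IsProbabilityMeasure μ] {T : X ≃ᵐ X}
    {P : ℕ → Finset ℤ} (hT : MeasurePreserving T μ μ) (hm : m ≤ mX)
    (h : hPfactor m μ T P = 0) {s : Set X} (hs : MeasurableSet[m] s) :
    IsZeroEntropySet μ T P s := by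
  classical
  let f : X → Fin 2 := fun x => if x ∈ s then 1 else 0
  have hfm : Measurable[m] f :=
    Measurable.ite hs (@measurable_const _ _ _ m _) (@measurable_const _ _ _ m _)
  have hf : Measurable f := hfm.mono hm le_rfl
  simp only [hPfactor, ENNReal.iSup_eq_zero, ENNReal.ofReal_eq_zero] at h
  have hmem : (· ∈ s) = fun x => f x = 1 := by
    ext x
    simp [f]
  refine ⟨hm s hs, ?_⟩
  rw [hmem]
  exact tendsto_hPj_comp hT hf (tendsto_hPj_of_hPpart_nonpos hT hf (h 2 f hfm)) (· = 1)

/-- A finite partition into sets of zero entropy has zero entropy. -/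
lemma tendsto_hPj_of_isZeroEntropySet_fiber (hT : MeasurePreserving T μ μ) {f : X → I}
    (hf : Measurable f) (h : ∀ i, IsZeroEntropySet μ T P (f ⁻¹' {i})) :
    Tendsto (fun j => hPj μ T (P j) f) atTop (𝓝 0) := by
  classical
  have hmeas (s : Finset I) : Measurable fun x i => i ∈ s ∧ f x = i :=
    Measurable.of_discrete.comp (g := fun k i => i ∈ s ∧ k = i) hf
  have H (s : Finset I) :
      Tendsto (fun j => hPj μ T (P j) fun x i => i ∈ s ∧ f x = i) atTop (𝓝 0) := by
    induction s using Finset.induction_on with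
    | empty =>
      simpa using tendsto_hPj_comp hT MeasurableSet.empty.mem (IsZeroEntropySet.empty hT).2
        fun p (_ : I) => p
    | insert a s ha ih =>
      have hins : (fun x i => i ∈ insert a s ∧ f x = i)
          = fun x i => (i = a ∧ x ∈ f ⁻¹' {a}) ∨ (i ∈ s ∧ f x = i) := by
        ext x i
        simp only [Finset.mem_insert, Set.mem_preimage, Set.mem_singleton_iff, or_and_right]
        exact or_congr_left (and_congr_right fun hi => by rw [hi])
      rw [hins]
      exact tendsto_hPj_comp₂ hT (h a).1.mem (hmeas s) (h a).2 ih fun p u i => (i = a ∧ p) ∨ u i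
  have : Nonempty I := (nonempty_of_isProbabilityMeasure μ).map f
  let ψ : I → I → Prop := fun k i => i ∈ Finset.univ ∧ k = i
  have hψ : ψ.Injective := fun k l hkl => by simpa [ψ] using congrFun hkl l
  have hf' : f = fun x => ψ.invFun (ψ (f x)) := by
    ext x
    exact (Function.leftInverse_invFun hψ (f x)).symm
  rw [hf']
  exact tendsto_hPj_comp hT (hmeas Finset.univ) (H Finset.univ) ψ.invFun

end ZeroEntropy

/-- Let `T` be an invertible measure-preserving transformation of a
standard probability space and `P = (P_j)` a sequence of finite nonempty subsets of `ℤ`.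
If the σ-algebra of `X` is generated, mod `μ`-null sets, by a countable family `(ℱ n)`
of `T`-invariant sub-σ-algebras each of zero `P`-entropy, then `h_P(T) = 0`
(zero `P`-entropy is hereditarily stable). -/
theorem hPent_eq_zero_of_generated {X : Type*} [mX : MeasurableSpace X]
    [StandardBorelSpace X] (μ : Measure X) [IsProbabilityMeasure μ]
    (T : X ≃ᵐ X) (hT : MeasurePreserving T μ μ)
    (P : ℕ → Finset ℤ) (hP : ∀ j, (P j).Nonempty)
    (F : ℕ → MeasurableSpace X) (hFle : ∀ n, F n ≤ mX)
    (hFinv : ∀ n, InvariantSubAlg μ T (F n))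
    (hgen : ∀ s : Set X, MeasurableSet s →
      ∃ t : Set X, MeasurableSet[⨆ n, F n] t ∧ μ (s ∆ t) = 0)
    (hzero : ∀ n, hPfactor (F n) μ T P = 0) :
    hPent μ T P = 0 := by
  have hzs {s : Set X} (hs : MeasurableSet s) : IsZeroEntropySet μ T P s := by
    obtain ⟨t, ht, hst⟩ := hgen s hs
    have hle : ⨆ n, F n ≤ IsZeroEntropySet.measurableSpace P hT := iSup_le fun n _ hs =>
      isZeroEntropySet_of_hPfactor_eq_zero hT (hFle n) (hzero n) hs
    exact .of_symmDiff_null hT hs (hle t ht) hst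
  simp only [hPent, hPfactor, ENNReal.iSup_eq_zero, ENNReal.ofReal_eq_zero]
  intro n f hf
  exact (tendsto_hPj_of_isZeroEntropySet_fiber hT hf
    fun i => hzs (hf (measurableSet_singleton i))).limsup_eq.le
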